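/- (Correspondence on upward-flat frames) Let F = (W, ≼, R) be an upward-flat frame. Then: (1) F validates em := p∨¬p if and only if ≼ is symmetric; (2) F validates t□ := (⊤⇛p)→p if and only if for every w there exists v with w ≼ v and v R w; (3) F validates str := (p→q)→(p⇛q) if and only if wRv implies w ≼ v; (4) F validates p_a := (p⇛q)→(⊤⇛(p⇛q)) if and only if for all w, v, s with w R v R s there exists u ≽ w such that s ∈ R[u] and R[u] ⊆ R[v]. -/

import Mathlib

/-- Formulas of the language `L⇛`. -/
inductive Fml : Type where
  | var : Nat → Fml
  | top : Fml
  | bot : Fml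
  | and : Fml → Fml → Fml
  | or  : Fml → Fml → Fml
  | imp : Fml → Fml → Fml
  | sto : Fml → Fml → Fml
deriving DecidableEq

/-- Uniform substitution. -/
def Fml.subst (σ : Nat → Fml) : Fml → Fml
  | .var p => σ p
  | .top => .top
  | .bot => .bot
  | .and φ ψ => .and (φ.subst σ) (ψ.subst σ)
  | .or φ ψ => .or (φ.subst σ) (ψ.subst σ)
  | .imp φ ψ => .imp (φ.subst σ) (ψ.subst σ)
  | .sto φ ψ => .sto (φ.subst σ) (ψ.subst σ)

/-- Conjunction `φ₁ ∧ ⋯ ∧ φₙ` of a list of formulas (`⊤` for the empty list). -/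
def Fml.conj : List Fml → Fml
  | [] => .top
  | [φ] => φ
  | φ :: ψ :: rest => .and φ (Fml.conj (ψ :: rest))

/-- Disjunction `φ₁ ∨ ⋯ ∨ φₙ` of a list of formulas (`⊥` for the empty list). -/
def Fml.disj : List Fml → Fml
  | [] => .bot
  | [φ] => φ
  | φ :: ψ :: rest => .or φ (Fml.disj (ψ :: rest))

/-- A flat frame: a nonempty set of worlds with a preorder `≼` and a relation `R`. -/
structure FlatFrame : Type 1 where
  W : Type
  ne : Nonempty W
  le : W → W → Prop
  le_refl : ∀ w, le w w
  le_trans : ∀ ⦃w v u⦄, le w v → le v u → le w u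
  R : W → W → Prop

/-- A valuation is admissible if every proposition letter denotes an upset. -/
def FlatFrame.IsUpset (F : FlatFrame) (V : Nat → F.W → Prop) : Prop :=
  ∀ p ⦃w v⦄, F.le w v → V p w → V p v

/-- Truth of a formula at a world of a flat model: the usual intuitionistic Kripke
clauses over `≼`, and `w ⊨ φ⇛ψ` iff for every `w' ≽ w`, `R[w'] ⊆ ⟦φ⟧` implies
`R[w'] ⊆ ⟦ψ⟧`. -/
def FlatFrame.sat (F : FlatFrame) (V : Nat → F.W → Prop) : Fml → F.W → Prop
  | .var p, w => V p w
  | .top, _ => True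
  | .bot, _ => False
  | .and φ ψ, w => F.sat V φ w ∧ F.sat V ψ w
  | .or φ ψ, w => F.sat V φ w ∨ F.sat V ψ w
  | .imp φ ψ, w => ∀ v, F.le w v → F.sat V φ v → F.sat V ψ v
  | .sto φ ψ, w => ∀ w', F.le w w' →
      (∀ v, F.R w' v → F.sat V φ v) → ∀ v, F.R w' v → F.sat V ψ v

/-- A flat frame validates the consecution `Γ ⇒ φ` if in every model on it, every
world satisfying all formulas of `Γ` satisfies `φ`. -/
def FlatFrame.ValidCons (F : FlatFrame) (Γ : Set Fml) (φ : Fml) : Prop :=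
  ∀ V, F.IsUpset V → ∀ w, (∀ ψ ∈ Γ, F.sat V ψ w) → F.sat V φ w

/-- A flat frame validates a formula if it is true at every world in every model on it. -/
def FlatFrame.ValidFml (F : FlatFrame) (φ : Fml) : Prop :=
  ∀ V, F.IsUpset V → ∀ w, F.sat V φ w

/-- `em := p ∨ ¬p` (where `¬φ` abbreviates `φ→⊥`). -/
def emFml : Fml := .or (.var 0) (.imp (.var 0) .bot)
/-- `t□ := (⊤⇛p)→p`. -/
def tbFml : Fml := .imp (.sto .top (.var 0)) (.var 0)
/-- `str := (p→q)→(p⇛q)`. -/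
def strFml : Fml := .imp (.imp (.var 0) (.var 1)) (.sto (.var 0) (.var 1))
/-- `p_a := (p⇛q)→(⊤⇛(p⇛q))`. -/
def paFml : Fml := .imp (.sto (.var 0) (.var 1)) (.sto .top (.sto (.var 0) (.var 1)))
/-- `4a := p⇛(⊤⇛p)`. -/
def fourAFml : Fml := .sto (.var 0) (.sto .top (.var 0))
/-- `di := ((p⇛r)∧(q⇛r))→((p∨q)⇛r)`. -/
def diFml : Fml := .imp (.and (.sto (.var 0) (.var 2)) (.sto (.var 1) (.var 2)))
    (.sto (.or (.var 0) (.var 1)) (.var 2))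

/-- correspondence on upward-flat frames for the axioms `em`, `t□`,
`str` and `p_a`. -/
theorem correspondence_upward_flat (F : FlatFrame)
    (hup : ∀ ⦃w v u : F.W⦄, F.R w v → F.le v u → F.R w u) :
    (F.ValidFml emFml ↔ ∀ ⦃w v : F.W⦄, F.le w v → F.le v w) ∧
    (F.ValidFml tbFml ↔ ∀ w : F.W, ∃ v, F.le w v ∧ F.R v w) ∧
    (F.ValidFml strFml ↔ ∀ ⦃w v : F.W⦄, F.R w v → F.le w v) ∧
    (F.ValidFml paFml ↔ ∀ ⦃w v s : F.W⦄, F.R w v → F.R v s →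
      ∃ u, F.le w u ∧ F.R u s ∧ ∀ t, F.R u t → F.R v t) := by
  refine ⟨⟨fun h w v hwv => ?_, fun h V hV w => ?_⟩,
    ⟨fun h w => ?_, fun h V hV _ x _ hx => ?_⟩,
    ⟨fun h w v hwv => ?_, fun h V hV _ x _ hx y hxy hp v hv => ?_⟩,
    ⟨fun h w v s hwv hvs => ?_, fun h V hV _ x _ hx y hxy _ v hyv z hvz hp s hs => ?_⟩⟩
  · rcases h (fun _ x => F.le v x) (fun _ _ _ hxy hx => F.le_trans hx hxy) w with hw | hw
    · exact hw
    · exact (hw v hwv (F.le_refl v)).elim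
  · by_cases hw : V 0 w
    · exact Or.inl hw
    · exact Or.inr fun v hwv hv => hw (hV 0 (h hwv) hv)
  · by_contra hne
    refine h (fun _ x => ¬ F.le x w) (fun _ _ _ hxy hx hyw => hx (F.le_trans hxy hyw)) w w
      (F.le_refl w) (fun u hwu _ t hut htw => ?_) (F.le_refl w)
    exact hne ⟨u, hwu, hup hut htw⟩
  · obtain ⟨v, hxv, hvx⟩ := h x
    exact hx v hxv (fun _ _ => trivial) x hvx
  · refine h (fun n x => if n = 0 then F.R w x else F.le w x) (fun n x y hxy hx => ?_) w w
      (F.le_refl w) (fun x hwx _ => ?_) w (F.le_refl w) (fun x hx => ?_) v hwv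
    · dsimp only at hx ⊢
      split_ifs at hx ⊢
      · exact hup hx hxy
      · exact F.le_trans hx hxy
    · exact hwx
    · exact hx
  · exact hx v (F.le_trans hxy (h hv)) (hp v hv)
  · by_contra hne
    refine h (fun n x => if n = 0 then F.R v x else ¬ F.le x s) (fun n x y hxy hx => ?_) w w
      (F.le_refl w) (fun u hwu hu t hut hts => ?_) w (F.le_refl w) (fun _ _ => trivial) v hwv v
      (F.le_refl v) (fun x hx => ?_) s hvs (F.le_refl s)
    · dsimp only at hx ⊢
      split_ifs at hx ⊢
      · exact hup hx hxy
      · exact fun hys => hx (F.le_trans hxy hys)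
    · exact hne ⟨u, hwu, hup hut hts, hu⟩
    · exact hx
  · obtain ⟨u, hyu, hus, hsub⟩ := h (hup hyv hvz) hs
    exact hx u (F.le_trans hxy hyu) (fun t ht => hp t (hsub t ht)) s hus
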